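/- (Refinement yields a coarser uncoordinated preorder) Let 𝕀 be an interface and 𝕀' a refinement of 𝕀, i.e., 𝕀' is an interface whose partition of Act is finer than that of 𝕀 (every part of 𝕀' is contained in some part of 𝕀). Then p ⊑^𝕀_unc q implies p ⊑^{𝕀'}_unc q. -/

import Mathlib

/-!
Common definitions: sequential CCS with success, configurations,
must testing, Mazurkiewicz traces, filtered traces, interfaces, and
the classical / uncoordinated / individualistic must preorders.
-/

namespace MultipartyTesting

/-- Actions: input or output over a name. -/
inductive Act (Name : Type) : Type where
  | inp : Name → Act Name
  | out : Name → Act Name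

/-- Complementation of actions (involutive). -/
def Act.co {Name : Type} : Act Name → Act Name
  | .inp a => .out a
  | .out a => .inp a

/-- Transition labels: visible actions, the internal action τ, and success ✓. -/
inductive Label (Name : Type) : Type where
  | act : Act Name → Label Name
  | tau : Label Name
  | tick : Label Name

/-- Sequential CCS with success (recursion via de Bruijn indices):
`p ::= 0 | 1 | μ.p | p+q | X | rec_X. p` where prefixes are actions (`pre`) or τ (`tpre`). -/
inductive Proc (Name : Type) : Type where
  | nil : Proc Name
  | one : Proc Name
  | pre : Act Name → Proc Name → Proc Name
  | tpre : Proc Name → Proc Name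
  | choice : Proc Name → Proc Name → Proc Name
  | var : ℕ → Proc Name
  | fix : Proc Name → Proc Name

namespace Proc

variable {Name : Type}

/-- de Bruijn lifting. -/
def lift (d : ℕ) : Proc Name → Proc Name
  | nil => nil
  | one => one
  | pre a p => pre a (lift d p)
  | tpre p => tpre (lift d p)
  | choice p q => choice (lift d p) (lift d q)
  | var k => if k < d then var k else var (k + 1)
  | fix p => fix (lift (d + 1) p)

/-- Substitution of `u` for de Bruijn index `d`. -/
def subst (d : ℕ) (u : Proc Name) : Proc Name → Proc Name
  | nil => nil
  | one => one
  | pre a p => pre a (subst d u p)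
  | tpre p => tpre (subst d u p)
  | choice p q => choice (subst d u p) (subst d u q)
  | var k => if k = d then u else if k < d then var k else var (k - 1)
  | fix p => fix (subst (d + 1) (lift 0 u) p)

/-- The set of actions occurring in a process (so `α` or `ᾱ` occurs in `p`
iff the corresponding name is in `n(p)`). -/
def acts : Proc Name → Set (Act Name)
  | nil => ∅
  | one => ∅
  | pre a p => insert a (acts p)
  | tpre p => acts p
  | choice p q => acts p ∪ acts q
  | var _ => ∅
  | fix p => acts p

end Proc

/-- The LTS on sequential processes. -/
inductive Step {Name : Type} : Proc Name → Label Name → Proc Name → Prop where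
  | one : Step Proc.one Label.tick Proc.nil
  | pre (a : Act Name) (p : Proc Name) : Step (Proc.pre a p) (Label.act a) p
  | tpre (p : Proc Name) : Step (Proc.tpre p) Label.tau p
  | choiceL {p l p'} (q) : Step p l p' → Step (Proc.choice p q) l p'
  | choiceR {q l q'} (p) : Step q l q' → Step (Proc.choice p q) l q'
  | fix {p l p'} : Step (Proc.subst 0 (Proc.fix p) p) l p' → Step (Proc.fix p) l p'

/-- Configurations: parallel compositions of processes; additionally
`hide V c` is the projection `c↾V` that hides (turns into τ) every action not in `V`. -/
inductive Conf (Name : Type) : Type where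
  | proc : Proc Name → Conf Name
  | par : Conf Name → Conf Name → Conf Name
  | hide : Set (Act Name) → Conf Name → Conf Name

/-- Pure configurations: parallel compositions of processes (no hiding),
i.e. the configurations of the paper. -/
inductive Conf.Pure {Name : Type} : Conf Name → Prop where
  | proc (p : Proc Name) : Pure (Conf.proc p)
  | par {c d} : Pure c → Pure d → Pure (Conf.par c d)

/-- The LTS on configurations: interleaving of non-✓ labels, synchronization of
complementary actions into τ, simultaneous ✓, and the projection rules. -/
inductive CStep {Name : Type} : Conf Name → Label Name → Conf Name → Prop where
  | proc {p l p'} : Step p l p' → CStep (Conf.proc p) l (Conf.proc p')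
  | parL {c l c'} (d) : CStep c l c' → l ≠ Label.tick →
      CStep (Conf.par c d) l (Conf.par c' d)
  | parR {d l d'} (c) : CStep d l d' → l ≠ Label.tick →
      CStep (Conf.par c d) l (Conf.par c d')
  | sync {c a c' d d'} : CStep c (Label.act a) c' → CStep d (Label.act (Act.co a)) d' →
      CStep (Conf.par c d) Label.tau (Conf.par c' d')
  | tick {c c' d d'} : CStep c Label.tick c' → CStep d Label.tick d' →
      CStep (Conf.par c d) Label.tick (Conf.par c' d')
  | hideV {V : Set (Act Name)} {c a c'} : CStep c (Label.act a) c' → a ∈ V →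
      CStep (Conf.hide V c) (Label.act a) (Conf.hide V c')
  | hideH {V : Set (Act Name)} {c a c'} : CStep c (Label.act a) c' → a ∉ V →
      CStep (Conf.hide V c) Label.tau (Conf.hide V c')
  | hideT {V : Set (Act Name)} {c c'} : CStep c Label.tau c' →
      CStep (Conf.hide V c) Label.tau (Conf.hide V c')

variable {Name : Type}

/-- Weak internal transitions `c ⇒ c'`. -/
def WTau : Conf Name → Conf Name → Prop :=
  Relation.ReflTransGen (fun c c' => CStep c Label.tau c')

/-- Weak visible transition `c ⇒^a c'`. -/
def WAct (c : Conf Name) (a : Act Name) (c' : Conf Name) : Prop :=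
  ∃ c₁ c₂, WTau c c₁ ∧ CStep c₁ (Label.act a) c₂ ∧ WTau c₂ c'

/-- Weak string transition `c ⇒^s c'` for `s ∈ Act*`. -/
inductive WString : Conf Name → List (Act Name) → Conf Name → Prop where
  | nil {c c'} : WTau c c' → WString c [] c'
  | cons {c a c₁ s c'} : WAct c a c₁ → WString c₁ s c' → WString c (a :: s) c'

/-- Traces of a configuration (restricted to strings over `Act`). -/
def Tr (c : Conf Name) : Set (List (Act Name)) := {s | ∃ c', WString c s c'}

/-- Divergence: an infinite sequence of τ-transitions. -/
def Div (c : Conf Name) : Prop :=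
  ∃ f : ℕ → Conf Name, f 0 = c ∧ ∀ n, CStep (f n) Label.tau (f (n + 1))

/-- Convergence. -/
def Conv (c : Conf Name) : Prop := ¬ Div c

/-- Convergence along a string: `c ⇓ s`. -/
def ConvS : Conf Name → List (Act Name) → Prop
  | c, [] => Conv c
  | c, a :: s => Conv c ∧ ∀ c', WAct c a c' → ConvS c' s

/-- `c MUST L`. -/
def MUSTone (c : Conf Name) (L : Set (Act Name)) : Prop :=
  ∀ c', WTau c c' → ∃ a ∈ L, ∃ c'', WAct c' a c''

/-- `P MUST L` for a set of configurations. -/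
def MUSTset (P : Set (Conf Name)) (L : Set (Act Name)) : Prop :=
  ∀ c ∈ P, MUSTone c L

/-- Residuals: `(c after s)`. -/
def after (c : Conf Name) (s : List (Act Name)) : Set (Conf Name) :=
  {c' | WString c s c'}

/-- `c must o`: every maximal τ-computation of `c ‖ o` (tracked componentwise)
contains a state whose observer component has a ✓-transition. -/
def MustPass (c o : Conf Name) : Prop :=
  ∀ cs os : ℕ → Conf Name, cs 0 = c → os 0 = o →
    ((∀ k, CStep (Conf.par (cs k) (os k)) Label.tau (Conf.par (cs (k + 1)) (os (k + 1)))) →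
       ∃ j, ∃ o', CStep (os j) Label.tick o') ∧
    (∀ n : ℕ,
       (∀ k < n, CStep (Conf.par (cs k) (os k)) Label.tau (Conf.par (cs (k + 1)) (os (k + 1)))) →
       (¬ ∃ d, CStep (Conf.par (cs n) (os n)) Label.tau d) →
       ∃ j ≤ n, ∃ o', CStep (os j) Label.tick o')

/-- The classical must preorder `p ⊑_must q` (observers are all configurations
of the paper, i.e. pure configurations). -/
def MustLeq (p q : Proc Name) : Prop :=
  ∀ o : Conf Name, o.Pure → MustPass (Conf.proc p) o → MustPass (Conf.proc q) o

/-- An interface: a partition `{I_i}_{i ∈ 0..n}` of `Act` closed under complementation. -/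
structure Interface (Name : Type) (n : ℕ) where
  part : Fin (n + 1) → Set (Act Name)
  cover : ∀ a, ∃ i, a ∈ part i
  disjoint : ∀ i j, i ≠ j → ∀ a, a ∈ part i → a ∉ part j
  nonempty : ∀ i, (part i).Nonempty
  coClosed : ∀ i a, a ∈ part i → Act.co a ∈ part i

/-- `o₀ ‖ o₁ ‖ … ‖ o_n` as a configuration. -/
def parOfList (p : Proc Name) : List (Proc Name) → Conf Name
  | [] => Conf.proc p
  | q :: qs => Conf.par (Conf.proc p) (parOfList q qs)

/-- The parallel composition of an indexed family of processes. -/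
def parComp {n : ℕ} (os : Fin (n + 1) → Proc Name) : Conf Name :=
  parOfList (os 0) (List.ofFn fun i : Fin n => os i.succ)

/-- The uncoordinated must preorder `p ⊑^𝕀_unc q`. -/
def UncLeq {n : ℕ} (𝕀 : Interface Name n) (p q : Proc Name) : Prop :=
  ∀ os : Fin (n + 1) → Proc Name, (∀ i, Proc.acts (os i) ⊆ 𝕀.part i) →
    MustPass (Conf.proc p) (parComp os) → MustPass (Conf.proc q) (parComp os)

/-- The individualistic must preorder `p ⊑^𝕀_ind q`. -/
def IndLeq {n : ℕ} (𝕀 : Interface Name n) (p q : Proc Name) : Prop :=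
  ∀ os : Fin (n + 1) → Proc Name, (∀ i, Proc.acts (os i) ⊆ 𝕀.part i) →
    ∀ i, MustPass (Conf.hide (𝕀.part i) (Conf.proc p)) (Conf.proc (os i)) →
         MustPass (Conf.hide (𝕀.part i) (Conf.proc q)) (Conf.proc (os i))

/-- One swap of adjacent independent actions (w.r.t. a dependency relation `D`). -/
inductive SwapStep (D : Set (Act Name × Act Name)) :
    List (Act Name) → List (Act Name) → Prop where
  | swap (u v : List (Act Name)) (a b : Act Name) :
      (a, b) ∉ D → SwapStep D (u ++ a :: b :: v) (u ++ b :: a :: v)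

/-- Mazurkiewicz trace equivalence `≡_D`: the least congruence on `Act*`
with `αβ ≡ βα` whenever `(α,β) ∉ D`. -/
def MEquiv (D : Set (Act Name × Act Name)) : List (Act Name) → List (Act Name) → Prop :=
  Relation.EqvGen (SwapStep D)

/-- The dependency relation induced by an interface: `D = ∪_{I∈𝕀} I×I`. -/
def DepOf {n : ℕ} (𝕀 : Interface Name n) : Set (Act Name × Act Name) :=
  {x | ∃ i, x.1 ∈ 𝕀.part i ∧ x.2 ∈ 𝕀.part i}

/-- `c ⇓ [s]_D`. -/
def ConvMC (c : Conf Name) (D : Set (Act Name × Act Name)) (s : List (Act Name)) : Prop :=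
  ∀ t, MEquiv D s t → ConvS c t

/-- `(c after [s]_D)`. -/
def afterMC (c : Conf Name) (D : Set (Act Name × Act Name)) (s : List (Act Name)) :
    Set (Conf Name) :=
  {c' | ∃ t, MEquiv D s t ∧ WString c t c'}

/-- The trace-based characterisation `p ≼^𝕀 q` of the uncoordinated preorder. -/
def TraceLeqUnc {n : ℕ} (𝕀 : Interface Name n) (p q : Proc Name) : Prop :=
  ∀ (s : List (Act Name)) (i : Fin (n + 1)) (L : Set (Act Name)),
    L.Finite → L ⊆ 𝕀.part i → ConvMC (Conf.proc p) (DepOf 𝕀) s →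
      ConvMC (Conf.proc q) (DepOf 𝕀) s ∧
      (MUSTset (afterMC (Conf.proc p) (DepOf 𝕀) s) L →
       MUSTset (afterMC (Conf.proc q) (DepOf 𝕀) s) L)

open Classical in
/-- `s↾I`: the subsequence of `s` consisting of its symbols in `I`. -/
noncomputable def fproj (I : Set (Act Name)) (s : List (Act Name)) : List (Act Name) :=
  s.filter fun a => decide (a ∈ I)

/-- `c ⇓ ⟨s⟩_I`. -/
def ConvFC (c : Conf Name) (I : Set (Act Name)) (s : List (Act Name)) : Prop :=
  ∀ t, fproj I t = fproj I s → ConvS c t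

/-- `(c after ⟨s⟩_I)`. -/
def afterFC (c : Conf Name) (I : Set (Act Name)) (s : List (Act Name)) :
    Set (Conf Name) :=
  {c' | ∃ t, fproj I t = fproj I s ∧ WString c t c'}

/-- The filtered-trace characterisation `p ≼^𝕀_flt q` of the individualistic preorder. -/
def TraceLeqInd {n : ℕ} (𝕀 : Interface Name n) (p q : Proc Name) : Prop :=
  ∀ (i : Fin (n + 1)) (s : List (Act Name)), (∀ a ∈ s, a ∈ 𝕀.part i) →
    ∀ L : Set (Act Name), L.Finite → L ⊆ 𝕀.part i →
      ConvFC (Conf.proc p) (𝕀.part i) s →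
        ConvFC (Conf.proc q) (𝕀.part i) s ∧
        (MUSTset (afterFC (Conf.proc p) (𝕀.part i) s) (L ∪ (𝕀.part i)ᶜ) →
         MUSTset (afterFC (Conf.proc q) (𝕀.part i) s) (L ∪ (𝕀.part i)ᶜ))

/-- A configuration is unsuccessful if it has no ✓-transition. -/
def Unsucc (c : Conf Name) : Prop := ¬ ∃ c', CStep c Label.tick c'

/-- Unsuccessful weak internal transitions: all states passed through are unsuccessful. -/
inductive UTau : Conf Name → Conf Name → Prop where
  | refl {c} : Unsucc c → UTau c c
  | step {c c₁ c'} : Unsucc c → CStep c Label.tau c₁ → UTau c₁ c' → UTau c c'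

/-- Unsuccessful weak visible transition. -/
def UWAct (c : Conf Name) (a : Act Name) (c' : Conf Name) : Prop :=
  ∃ c₁ c₂, UTau c c₁ ∧ CStep c₁ (Label.act a) c₂ ∧ UTau c₂ c'

/-- Unsuccessful weak string transition (an unsuccessful weak computation `c ⇒^s c'`). -/
inductive UWString : Conf Name → List (Act Name) → Conf Name → Prop where
  | nil {c c'} : UTau c c' → UWString c [] c'
  | cons {c a c₁ s c'} : UWAct c a c₁ → UWString c₁ s c' → UWString c (a :: s) c'

namespace Proc

theorem lift_lift (t : Proc Name) : ∀ {d e : ℕ}, e ≤ d →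
    lift e (lift d t) = lift (d + 1) (lift e t) := by
  induction t with
  | nil => intros; rfl
  | one => intros; rfl
  | pre a p ih => intro d e h; simp only [lift, ih h]
  | tpre p ih => intro d e h; simp only [lift, ih h]
  | choice p q ihp ihq => intro d e h; simp only [lift, ihp h, ihq h]
  | var k =>
    intro d e h
    simp only [lift]
    split_ifs <;> simp only [lift] <;> split_ifs <;> first | rfl | omega
  | fix p ih => intro d e h; simp only [lift, ih (Nat.succ_le_succ h)]

theorem lift_subst (t : Proc Name) : ∀ {d e : ℕ} (u : Proc Name), e ≤ d →
    lift e (subst d u t) = subst (d + 1) (lift e u) (lift e t) := by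
  induction t with
  | nil => intros; rfl
  | one => intros; rfl
  | pre a p ih => intro d e u h; simp only [lift, subst, ih u h]
  | tpre p ih => intro d e u h; simp only [lift, subst, ih u h]
  | choice p q ihp ihq => intro d e u h; simp only [lift, subst, ihp u h, ihq u h]
  | var k =>
    intro d e u h
    simp only [lift, subst]
    split_ifs <;> simp only [lift, subst] <;> split_ifs <;>
      first | rfl | omega | (congr 1; omega)
  | fix p ih =>
    intro d e u h
    simp only [lift, subst, ih (lift 0 u) (Nat.succ_le_succ h), lift_lift u (Nat.zero_le e)]

theorem subst_lift (t : Proc Name) : ∀ (e : ℕ) (v : Proc Name), subst e v (lift e t) = t := by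
  induction t with
  | nil => intros; rfl
  | one => intros; rfl
  | pre a p ih => intro e v; simp only [lift, subst, ih]
  | tpre p ih => intro e v; simp only [lift, subst, ih]
  | choice p q ihp ihq => intro e v; simp only [lift, subst, ihp, ihq]
  | var k =>
    intro e v
    simp only [lift]
    split_ifs <;> simp only [subst] <;> split_ifs <;> first | rfl | omega
  | fix p ih => intro e v; simp only [lift, subst, ih]

theorem subst_subst (t : Proc Name) : ∀ {d e : ℕ} (u v : Proc Name), e ≤ d →
    subst d u (subst e v t) = subst e (subst d u v) (subst (d + 1) (lift e u) t) := by
  induction t with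
  | nil => intros; rfl
  | one => intros; rfl
  | pre a p ih => intro d e u v h; simp only [subst, ih u v h]
  | tpre p ih => intro d e u v h; simp only [subst, ih u v h]
  | choice p q ihp ihq => intro d e u v h; simp only [subst, ihp u v h, ihq u v h]
  | var k =>
    intro d e u v h
    rcases lt_trichotomy k e with hk | hk | hk
    · have h1 : k ≠ e := by omega
      have h2 : k ≠ d := by omega
      have h3 : k < d := by omega
      have h4 : k ≠ d + 1 := by omega
      have h5 : k < d + 1 := by omega
      simp [subst, h1, h2, h3, h4, h5, hk]
    · have h4 : k ≠ d + 1 := by omega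
      have h5 : k < d + 1 := by omega
      simp only [subst, if_pos hk, if_neg h4, if_pos h5]
    · rcases lt_trichotomy k (d + 1) with hd | hd | hd
      · have h1 : k ≠ e := by omega
        have h2 : ¬ k < e := by omega
        have h3 : k - 1 ≠ d := by omega
        have h4 : k - 1 < d := by omega
        have h5 : k ≠ d + 1 := by omega
        simp [subst, h1, h2, h3, h4, h5, hd]
      · have h1 : k ≠ e := by omega
        have h2 : ¬ k < e := by omega
        have h3 : k - 1 = d := by omega
        simp only [subst, if_neg h1, if_neg h2, if_pos h3, if_pos hd, subst_lift]
      · have h1 : k ≠ e := by omega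
        have h2 : ¬ k < e := by omega
        have h3 : k - 1 ≠ d := by omega
        have h4 : ¬ k - 1 < d := by omega
        have h5 : k ≠ d + 1 := by omega
        have h6 : ¬ k < d + 1 := by omega
        have h7 : k - 1 ≠ e := by omega
        have h8 : ¬ k - 1 < e := by omega
        simp [subst, h1, h2, h3, h4, h5, h6, h7, h8]
  | fix p ih =>
    intro d e u v h
    simp only [subst, ih (lift 0 u) (lift 0 v) (Nat.succ_le_succ h),
      lift_lift u (Nat.zero_le e), lift_subst v u (Nat.zero_le d)]

theorem subst_unfold (d : ℕ) (u p : Proc Name) :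
    subst d u (subst 0 (fix p) p) =
      subst 0 (fix (subst (d + 1) (lift 0 u) p)) (subst (d + 1) (lift 0 u) p) :=
  subst_subst p u (fix p) (Nat.zero_le d)

theorem acts_lift (t : Proc Name) : ∀ d : ℕ, acts (lift d t) = acts t := by
  induction t with
  | nil => intros; rfl
  | one => intros; rfl
  | pre a p ih => intro d; simp only [lift, acts, ih]
  | tpre p ih => intro d; simp only [lift, acts, ih]
  | choice p q ihp ihq => intro d; simp only [lift, acts, ihp, ihq]
  | var k => intro d; simp only [lift]; split_ifs <;> rfl
  | fix p ih => intro d; simp only [lift, acts, ih]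

theorem acts_subst_subset (t : Proc Name) : ∀ (d : ℕ) (u : Proc Name),
    acts (subst d u t) ⊆ acts t ∪ acts u := by
  induction t with
  | nil => intro d u; simp [subst, acts]
  | one => intro d u; simp [subst, acts]
  | pre a p ih =>
    intro d u
    simp only [subst, acts, Set.insert_union]
    exact Set.insert_subset_insert (ih d u)
  | tpre p ih => intro d u; exact ih d u
  | choice p q ihp ihq =>
    intro d u
    simp only [subst, acts]
    exact Set.union_subset
      ((ihp d u).trans (Set.union_subset_union_left _ Set.subset_union_left))
      ((ihq d u).trans (Set.union_subset_union_left _ Set.subset_union_right))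
  | var k => intro d u; simp only [subst]; split_ifs <;> simp [acts]
  | fix p ih =>
    intro d u
    have := ih (d + 1) (lift 0 u)
    rwa [acts_lift] at this

theorem acts_finite (t : Proc Name) : (acts t).Finite := by
  induction t with
  | nil => exact Set.finite_empty
  | one => exact Set.finite_empty
  | pre a p ih => exact ih.insert a
  | tpre p ih => exact ih
  | choice p q ihp ihq => exact ihp.union ihq
  | var k => exact Set.finite_empty
  | fix p ih => exact ih

/-- Prefixing with an arbitrary label; success has no continuation. -/
def pref : Label Name → Proc Name → Proc Name
  | .act a, p => pre a p
  | .tau, p => tpre p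
  | .tick, _ => one

/-- Finite sums. -/
def sum : List (Proc Name) → Proc Name
  | [] => nil
  | p :: ps => choice p (sum ps)

end Proc

theorem acts_unfold_subset (p : Proc Name) :
    Proc.acts (Proc.subst 0 (Proc.fix p) p) ⊆ Proc.acts p :=
  (Proc.acts_subst_subset p 0 _).trans (Set.union_subset subset_rfl subset_rfl)

namespace Step

theorem acts_subset {p p' : Proc Name} {l : Label Name} (h : Step p l p') :
    Proc.acts p' ⊆ Proc.acts p := by
  induction h with
  | one => exact subset_rfl
  | pre a p => exact Set.subset_insert _ _
  | tpre p => exact subset_rfl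
  | choiceL q _ ih => exact ih.trans Set.subset_union_left
  | choiceR p _ ih => exact ih.trans Set.subset_union_right
  | fix _ ih => exact ih.trans (acts_unfold_subset _)

theorem mem_acts {p p' : Proc Name} {l : Label Name} (h : Step p l p') :
    ∀ {a : Act Name}, l = .act a → a ∈ Proc.acts p := by
  induction h with
  | one => intro a h; cases h
  | pre a p => intro b h; cases h; exact Set.mem_insert _ _
  | tpre p => intro a h; cases h
  | choiceL q _ ih => intro a h; exact Or.inl (ih h)
  | choiceR p _ ih => intro a h; exact Or.inr (ih h)
  | @fix p _ _ _ ih => intro a h; exact acts_unfold_subset p (ih h)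

/-- A step of an instance `r[rec p]` is an instance of a step of `r` or of `p`. -/
theorem of_subst_fix {p x t : Proc Name} {l : Label Name} (h : Step x l t) :
    ∀ r, x = Proc.subst 0 (Proc.fix p) r →
      ∃ r', (Step r l r' ∨ Step p l r') ∧ t = Proc.subst 0 (Proc.fix p) r' := by
  induction h with
  | one =>
    intro r hr
    cases r with
    | one => exact ⟨_, .inl .one, rfl⟩
    | var k => simp only [Proc.subst] at hr; split_ifs at hr
    | _ => cases hr
  | pre a q =>
    intro r hr
    cases r with
    | pre b r => cases hr; exact ⟨_, .inl (.pre _ _), rfl⟩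
    | var k => simp only [Proc.subst] at hr; split_ifs at hr
    | _ => cases hr
  | tpre q =>
    intro r hr
    cases r with
    | tpre r => cases hr; exact ⟨_, .inl (.tpre _), rfl⟩
    | var k => simp only [Proc.subst] at hr; split_ifs at hr
    | _ => cases hr
  | choiceL q _ ih =>
    intro r hr
    cases r with
    | choice r₁ r₂ =>
      cases hr
      obtain ⟨r', h' | h', rfl⟩ := ih r₁ rfl
      · exact ⟨r', .inl (.choiceL _ h'), rfl⟩
      · exact ⟨r', .inr h', rfl⟩
    | var k => simp only [Proc.subst] at hr; split_ifs at hr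
    | _ => cases hr
  | choiceR q _ ih =>
    intro r hr
    cases r with
    | choice r₁ r₂ =>
      cases hr
      obtain ⟨r', h' | h', rfl⟩ := ih r₂ rfl
      · exact ⟨r', .inl (.choiceR _ h'), rfl⟩
      · exact ⟨r', .inr h', rfl⟩
    | var k => simp only [Proc.subst] at hr; split_ifs at hr
    | _ => cases hr
  | fix _ ih =>
    intro r hr
    cases r with
    | fix r =>
      cases hr
      obtain ⟨r', h' | h', rfl⟩ := ih (Proc.subst 0 (Proc.fix r) r)
        (Proc.subst_unfold 0 (Proc.fix p) r).symm
      · exact ⟨r', .inl (.fix h'), rfl⟩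
      · exact ⟨r', .inr h', rfl⟩
    | var k =>
      simp only [Proc.subst] at hr
      split_ifs at hr
      · cases hr
        obtain ⟨r', h', rfl⟩ := ih p rfl
        exact ⟨r', .inr (h'.elim id id), rfl⟩
    | _ => cases hr

end Step

theorem exists_finite_closed (p : Proc Name) : ∃ F : Set (Proc Name), F.Finite ∧ p ∈ F ∧
    ∀ r ∈ F, ∀ l r', Step r l r' → r' ∈ F := by
  induction p with
  | nil =>
    refine ⟨{Proc.nil}, Set.finite_singleton _, rfl, ?_⟩
    rintro r rfl l r' h; cases h
  | one =>
    refine ⟨{Proc.one, Proc.nil}, Set.toFinite _, Or.inl rfl, ?_⟩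
    rintro r (rfl | rfl) l r' h
    · cases h; exact Or.inr rfl
    · cases h
  | pre a p ih =>
    obtain ⟨F, hF, hp, hc⟩ := ih
    refine ⟨insert (Proc.pre a p) F, hF.insert _, Or.inl rfl, ?_⟩
    rintro r (rfl | hr) l r' h
    · cases h; exact Or.inr hp
    · exact Or.inr (hc r hr l r' h)
  | tpre p ih =>
    obtain ⟨F, hF, hp, hc⟩ := ih
    refine ⟨insert (Proc.tpre p) F, hF.insert _, Or.inl rfl, ?_⟩
    rintro r (rfl | hr) l r' h
    · cases h; exact Or.inr hp
    · exact Or.inr (hc r hr l r' h)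
  | choice p q ihp ihq =>
    obtain ⟨F, hF, hp, hc⟩ := ihp
    obtain ⟨G, hG, hq, hd⟩ := ihq
    refine ⟨insert (Proc.choice p q) (F ∪ G), (hF.union hG).insert _, Or.inl rfl, ?_⟩
    rintro r (rfl | hr | hr) l r' h
    · cases h with
      | choiceL _ h => exact Or.inr (Or.inl (hc _ hp _ _ h))
      | choiceR _ h => exact Or.inr (Or.inr (hd _ hq _ _ h))
    · exact Or.inr (Or.inl (hc r hr l r' h))
    · exact Or.inr (Or.inr (hd r hr l r' h))
  | var k =>
    refine ⟨{Proc.var k}, Set.finite_singleton _, rfl, ?_⟩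
    rintro r rfl l r' h; cases h
  | fix p ih =>
    obtain ⟨F, hF, hp, hc⟩ := ih
    refine ⟨Proc.subst 0 (Proc.fix p) '' insert (Proc.var 0) F, (hF.insert _).image _,
      ⟨Proc.var 0, Or.inl rfl, by simp [Proc.subst]⟩, ?_⟩
    rintro _ ⟨r, hr, rfl⟩ l t h
    obtain ⟨r', h' | h', rfl⟩ := h.of_subst_fix r rfl
    · refine ⟨r', Or.inr ?_, rfl⟩
      rcases hr with rfl | hr
      · cases h'
      · exact hc r hr l r' h'
    · exact ⟨r', Or.inr (hc p hp l r' h'), rfl⟩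

theorem step_sum_iff {ps : List (Proc Name)} {l : Label Name} {x : Proc Name} :
    Step (Proc.sum ps) l x ↔ ∃ p ∈ ps, Step p l x := by
  induction ps with
  | nil => simp only [Proc.sum, List.not_mem_nil, false_and, exists_false, iff_false]; nofun
  | cons p ps ih =>
    simp only [Proc.sum, List.exists_mem_cons_iff, ← ih]
    constructor
    · intro h
      cases h with
      | choiceL _ h => exact Or.inl h
      | choiceR _ h => exact Or.inr h
    · rintro (h | h)
      · exact .choiceL _ h
      · exact .choiceR _ h

theorem step_fix_iff {p x : Proc Name} {l : Label Name} :
    Step (Proc.fix p) l x ↔ Step (Proc.subst 0 (Proc.fix p) p) l x :=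
  ⟨fun h => by cases h; assumption, .fix⟩

section Regular

variable {α : Type} [DecidableEq α] (next : α → List (Label Name × α))

/-- The term for state `s` of the transition system `next`, below binders for the
states in `v` (innermost first). -/
def stateTerm : ℕ → List α → α → Proc Name
  | 0, _, _ => Proc.nil
  | f + 1, v, s =>
    if s ∈ v then Proc.var (v.idxOf s)
    else Proc.fix (Proc.sum ((next s).map fun x => Proc.pref x.1 (stateTerm f (s :: v) x.2)))

/-- Closes a term below binders for `v`, replacing variables by the terms of their states. -/
def closeTerm (N : ℕ) : List α → Proc Name → Proc Name
  | [], t => t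
  | s :: v, t => closeTerm N v (Proc.subst 0 (stateTerm next (N - v.length) v s) t)

variable {next}

theorem closeTerm_pref (N : ℕ) (v : List α) : ∀ (l : Label Name) (t : Proc Name),
    closeTerm next N v (Proc.pref l t) = Proc.pref l (closeTerm next N v t) := by
  induction v with
  | nil => intros; rfl
  | cons s v ih =>
    intro l t
    have : ∀ u, Proc.subst 0 u (Proc.pref l t) = Proc.pref l (Proc.subst 0 u t) := by
      intro u; cases l <;> rfl
    simp only [closeTerm, this, ih]

theorem closeTerm_sum (N : ℕ) (v : List α) : ∀ ps : List (Proc Name),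
    closeTerm next N v (Proc.sum ps) = Proc.sum (ps.map (closeTerm next N v)) := by
  induction v with
  | nil => intro ps; simp [closeTerm]
  | cons s v ih =>
    intro ps
    have : ∀ u, Proc.subst 0 u (Proc.sum ps) = Proc.sum (ps.map (Proc.subst 0 u)) := by
      intro u
      induction ps with
      | nil => rfl
      | cons p ps ih => simp only [Proc.sum, List.map_cons, Proc.subst, ih]
    simp only [closeTerm, this, ih, List.map_map]
    rfl

theorem exists_closeTerm_fix (N : ℕ) (v : List α) : ∀ b : Proc Name, ∃ b',
    closeTerm next N v (Proc.fix b) = Proc.fix b' ∧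
      closeTerm next N v (Proc.subst 0 (Proc.fix b) b) = Proc.subst 0 (Proc.fix b') b' := by
  induction v with
  | nil => exact fun b => ⟨b, rfl, rfl⟩
  | cons s v ih =>
    intro b
    simp only [closeTerm, Proc.subst_unfold]
    exact ih _

theorem exists_closeTerm_idxOf (N : ℕ) (s : α) : ∀ v : List α, v.Nodup → s ∈ v →
    ∃ w : List α, w.Nodup ∧ w ⊆ v ∧ s ∉ w ∧
      closeTerm next N v (Proc.var (v.idxOf s)) =
        closeTerm next N w (stateTerm next (N - w.length) w s) := by
  intro v
  induction v with
  | nil => intro _ h; cases h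
  | cons t v ih =>
    intro hv hs
    rw [List.nodup_cons] at hv
    by_cases hts : t = s
    · subst hts
      exact ⟨v, hv.2, List.subset_cons_self _ _, hv.1, by simp [closeTerm, Proc.subst]⟩
    · have hs' : s ∈ v := (List.mem_cons.1 hs).resolve_left (Ne.symm hts)
      obtain ⟨w, hw, hwv, hsw, he⟩ := ih hv.2 hs'
      refine ⟨w, hw, fun x hx => List.mem_cons_of_mem _ (hwv hx), hsw, ?_⟩
      rw [List.idxOf_cons_ne _ hts]
      simpa [closeTerm, Proc.subst] using he

theorem acts_stateTerm_subset {S : Set α} {A : Set (Act Name)}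
    (hcl : ∀ s ∈ S, ∀ x ∈ next s, x.2 ∈ S)
    (hA : ∀ s ∈ S, ∀ a s', (Label.act a, s') ∈ next s → a ∈ A) (f : ℕ) :
    ∀ v, ∀ s ∈ S, Proc.acts (stateTerm next f v s) ⊆ A := by
  induction f with
  | zero => intro v s _; exact Set.empty_subset _
  | succ f ih =>
    intro v s hs
    have hsum : ∀ ps : List (Proc Name), (∀ p ∈ ps, Proc.acts p ⊆ A) →
        Proc.acts (Proc.sum ps) ⊆ A := by
      intro ps
      induction ps with
      | nil => intro _; exact Set.empty_subset _
      | cons p ps ih =>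
        intro h
        exact Set.union_subset (h p List.mem_cons_self)
          (ih fun q hq => h q (List.mem_cons_of_mem _ hq))
    rw [stateTerm]
    split_ifs
    · exact Set.empty_subset _
    · refine hsum _ fun p hp => ?_
      obtain ⟨⟨l, s'⟩, hx, rfl⟩ := List.mem_map.1 hp
      have h' := ih (s :: v) s' (hcl s hs _ hx)
      cases l with
      | act a => exact Set.insert_subset (hA s hs a s' hx) h'
      | tau => exact h'
      | tick => exact Set.empty_subset _

variable (next) in
/-- The closed terms denoting a state `s` of the finite system on `S`. -/
def Denotes (S : Set α) (x : Proc Name) (s : α) : Prop :=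
  s ∈ S ∧ ∃ v : List α, v.Nodup ∧ (∀ t ∈ v, t ∈ S) ∧
    x = closeTerm next (S.ncard + 1) v (stateTerm next (S.ncard + 1 - v.length) v s)

theorem denotes_stateTerm {S : Set α} {s : α} (hs : s ∈ S) :
    Denotes next S (stateTerm next (S.ncard + 1) [] s) s :=
  ⟨hs, [], List.nodup_nil, by simp, rfl⟩

theorem Denotes.exists_step_iff {S : Set α} (hS : S.Finite)
    (hcl : ∀ s ∈ S, ∀ x ∈ next s, x.2 ∈ S) {x : Proc Name} {s : α} (h : Denotes next S x s) :
    ∃ k : α → Proc Name, (∀ l s', (l, s') ∈ next s → Denotes next S (k s') s') ∧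
      ∀ l x', Step x l x' ↔ ∃ y ∈ next s, Step (Proc.pref y.1 (k y.2)) l x' := by
  have hlen : ∀ v : List α, v.Nodup → (∀ t ∈ v, t ∈ S) → v.length ≤ S.ncard := by
    intro v hv hvS
    rw [← List.toFinset_card_of_nodup hv, ← Set.ncard_coe_finset]
    exact Set.ncard_le_ncard (fun t ht => hvS t (by simpa using ht)) hS
  obtain ⟨hs, v, hv, hvS, rfl⟩ := h
  obtain ⟨w, hw, hwS, hsw, he⟩ : ∃ w : List α, w.Nodup ∧ (∀ t ∈ w, t ∈ S) ∧ s ∉ w ∧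
      closeTerm next (S.ncard + 1) v (stateTerm next (S.ncard + 1 - v.length) v s) =
        closeTerm next (S.ncard + 1) w (stateTerm next (S.ncard + 1 - w.length) w s) := by
    by_cases hsv : s ∈ v
    · obtain ⟨w, hw, hwv, hsw, he⟩ :=
        exists_closeTerm_idxOf (next := next) (S.ncard + 1) s v hv hsv
      refine ⟨w, hw, fun t ht => hvS t (hwv ht), hsw, ?_⟩
      rw [← he, Nat.succ_sub (hlen v hv hvS), stateTerm, if_pos hsv]
    · exact ⟨v, hv, hvS, hsv, rfl⟩
  rw [he]
  have hw' : (s :: w).Nodup := List.nodup_cons.2 ⟨hsw, hw⟩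
  have hwS' : ∀ t ∈ s :: w, t ∈ S := by
    intro t ht
    rcases List.mem_cons.1 ht with rfl | ht
    · exact hs
    · exact hwS t ht
  refine ⟨fun s' => closeTerm next (S.ncard + 1) (s :: w)
      (stateTerm next (S.ncard + 1 - (s :: w).length) (s :: w) s'),
    fun l s' hx => ⟨hcl s hs _ hx, s :: w, hw', hwS', rfl⟩, fun l x' => ?_⟩
  have hf : stateTerm next (S.ncard + 1 - w.length) w s =
      Proc.fix (Proc.sum ((next s).map fun x => Proc.pref x.1
        (stateTerm next (S.ncard + 1 - (s :: w).length) (s :: w) x.2))) := by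
    rw [Nat.succ_sub (hlen w hw hwS), stateTerm, if_neg hsw, List.length_cons,
      Nat.succ_sub_succ]
  set b := Proc.sum ((next s).map fun x => Proc.pref x.1
        (stateTerm next (S.ncard + 1 - (s :: w).length) (s :: w) x.2)) with hb
  obtain ⟨b', h1, h2⟩ := exists_closeTerm_fix (next := next) (S.ncard + 1) w b
  have h3 : closeTerm next (S.ncard + 1) w (Proc.subst 0 (Proc.fix b) b) =
      closeTerm next (S.ncard + 1) (s :: w) b := by rw [closeTerm, hf]
  rw [hf, h1, step_fix_iff, ← h2, h3, hb, closeTerm_sum, step_sum_iff]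
  simp only [List.mem_map, exists_exists_and_eq_and, closeTerm_pref]

theorem step_pref_iff {l l' : Label Name} {p x : Proc Name} (hl : l' ≠ .tick) :
    Step (Proc.pref l p) l' x ↔ l = l' ∧ p = x := by
  constructor
  · intro h
    cases l <;> cases h <;> first | exact ⟨rfl, rfl⟩ | exact absurd rfl hl
  · rintro ⟨rfl, rfl⟩
    cases l
    · exact .pre _ _
    · exact .tpre _
    · exact absurd rfl hl

theorem exists_step_tick_pref_iff {l : Label Name} {p : Proc Name} :
    (∃ x, Step (Proc.pref l p) .tick x) ↔ l = .tick := by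
  constructor
  · rintro ⟨x, h⟩
    cases l <;> cases h
    rfl
  · rintro rfl
    exact ⟨_, .one⟩

theorem Denotes.of_step {S : Set α} (hS : S.Finite)
    (hcl : ∀ s ∈ S, ∀ x ∈ next s, x.2 ∈ S) {x x' : Proc Name} {s : α} {l : Label Name}
    (h : Denotes next S x s) (hx : Step x l x') (hl : l ≠ .tick) :
    ∃ s', (l, s') ∈ next s ∧ Denotes next S x' s' := by
  obtain ⟨k, hk, hst⟩ := h.exists_step_iff hS hcl
  obtain ⟨⟨l', s'⟩, hy, h'⟩ := (hst l x').1 hx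
  obtain ⟨rfl, rfl⟩ := (step_pref_iff hl).1 h'
  exact ⟨s', hy, hk _ s' hy⟩

theorem Denotes.exists_step {S : Set α} (hS : S.Finite)
    (hcl : ∀ s ∈ S, ∀ x ∈ next s, x.2 ∈ S) {x : Proc Name} {s s' : α} {l : Label Name}
    (h : Denotes next S x s) (hx : (l, s') ∈ next s) (hl : l ≠ .tick) :
    ∃ x', Step x l x' ∧ Denotes next S x' s' := by
  obtain ⟨k, hk, hst⟩ := h.exists_step_iff hS hcl
  exact ⟨k s', (hst l _).2 ⟨_, hx, (step_pref_iff hl).2 ⟨rfl, rfl⟩⟩, hk _ s' hx⟩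

theorem Denotes.exists_step_tick_iff {S : Set α} (hS : S.Finite)
    (hcl : ∀ s ∈ S, ∀ x ∈ next s, x.2 ∈ S) {x : Proc Name} {s : α}
    (h : Denotes next S x s) :
    (∃ x', Step x .tick x') ↔ ∃ s', (Label.tick, s') ∈ next s := by
  obtain ⟨k, hk, hst⟩ := h.exists_step_iff hS hcl
  constructor
  · rintro ⟨x', hx⟩
    obtain ⟨⟨l, s'⟩, hy, h'⟩ := (hst _ x').1 hx
    obtain rfl := exists_step_tick_pref_iff.1 ⟨x', h'⟩
    exact ⟨s', hy⟩
  · rintro ⟨s', hs'⟩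
    exact ⟨_, (hst _ _).2 ⟨_, hs', .one⟩⟩

end Regular

/-- Strong bisimulations, where for ✓ only its availability is compared. -/
structure IsBisim (B : Conf Name → Conf Name → Prop) : Prop where
  forth : ∀ {c d l c'}, B c d → l ≠ .tick → CStep c l c' → ∃ d', CStep d l d' ∧ B c' d'
  back : ∀ {c d l d'}, B c d → l ≠ .tick → CStep d l d' → ∃ c', CStep c l c' ∧ B c' d'
  tick_iff : ∀ {c d}, B c d → ((∃ c', CStep c .tick c') ↔ ∃ d', CStep d .tick d')

namespace IsBisim

variable {B : Conf Name → Conf Name → Prop}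

theorem flip (hB : IsBisim B) : IsBisim (Function.swap B) where
  forth h := hB.back h
  back h := hB.forth h
  tick_iff h := (hB.tick_iff h).symm

theorem par_forth (hB : IsBisim B) {c c' o o' u : Conf Name} (h : B o u)
    (hs : CStep (.par c o) .tau (.par c' o')) :
    ∃ u', CStep (.par c u) .tau (.par c' u') ∧ B o' u' := by
  cases hs with
  | parL _ h' hl => exact ⟨u, .parL _ h' hl, h⟩
  | parR _ h' hl =>
    obtain ⟨u', hu, hb⟩ := hB.forth h hl h'
    exact ⟨u', .parR _ hu hl, hb⟩
  | sync h₁ h₂ =>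
    obtain ⟨u', hu, hb⟩ := hB.forth h (by simp) h₂
    exact ⟨u', .sync h₁ hu, hb⟩

open Classical in
theorem mustPass (hB : IsBisim B) {c o u : Conf Name} (h : B o u) (hu : MustPass c u) :
    MustPass c o := by
  intro cs os hcs hos
  let good (k : ℕ) (x y : Conf Name) : Prop :=
    CStep (.par (cs k) x) .tau (.par (cs (k + 1)) y) ∧ B (os (k + 1)) y
  let us : ℕ → Conf Name := fun k => k.rec u fun k x =>
    if hx : ∃ y, good k x y then hx.choose else x
  have hus : ∀ k, (∃ y, good k (us k) y) → good k (us k) (us (k + 1)) := by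
    intro k hk
    have : us (k + 1) = hk.choose := dif_pos hk
    rw [this]
    exact hk.choose_spec
  have key : ∀ n, (∀ k < n, CStep (.par (cs k) (os k)) .tau (.par (cs (k + 1)) (os (k + 1)))) →
      B (os n) (us n) ∧
        ∀ k < n, CStep (.par (cs k) (us k)) .tau (.par (cs (k + 1)) (us (k + 1))) := by
    intro n
    induction n with
    | zero => intro _; exact ⟨hos ▸ h, by simp⟩
    | succ n ih =>
      intro hst
      obtain ⟨hb, hprev⟩ := ih fun k hk => hst k (by omega)
      have hg := hus n (hB.par_forth hb (hst n (by omega)))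
      refine ⟨hg.2, fun k hk => ?_⟩
      rcases Nat.lt_succ_iff_lt_or_eq.1 hk with hk | rfl
      · exact hprev k hk
      · exact hg.1
  obtain ⟨hinf, hfin⟩ := hu cs us hcs rfl
  constructor
  · intro hst
    obtain ⟨j, hj⟩ := hinf fun k => (key (k + 1) fun i _ => hst i).2 k (by omega)
    exact ⟨j, (hB.tick_iff (key j fun i _ => hst i).1).2 hj⟩
  · intro n hst hstuck
    obtain ⟨hb, hst'⟩ := key n hst
    obtain ⟨j, hj, hj'⟩ := hfin n hst' fun ⟨d, hd⟩ => hstuck <| by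
      have : ∃ c' u', d = .par c' u' := by cases hd <;> exact ⟨_, _, rfl⟩
      obtain ⟨c', u', rfl⟩ := this
      obtain ⟨o', ho', -⟩ := hB.flip.par_forth hb hd
      exact ⟨_, ho'⟩
    exact ⟨j, hj, (hB.tick_iff (key j fun i hi => hst i (by omega)).1).2 hj'⟩

end IsBisim

theorem parComp_succ {n : ℕ} (os : Fin (n + 2) → Proc Name) :
    parComp os = .par (.proc (os 0)) (parComp fun i => os i.succ) := by
  simp [parComp, parOfList, List.ofFn_succ]

theorem CStep.parComp_update {n : ℕ} {l : Label Name} (hl : l ≠ .tick) :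
    ∀ {os : Fin (n + 1) → Proc Name} {j : Fin (n + 1)} {r : Proc Name}, Step (os j) l r →
      CStep (parComp os) l (parComp (Function.update os j r)) := by
  induction n with
  | zero =>
    intro os j r h
    obtain rfl : j = 0 := Fin.fin_one_eq_zero j
    simpa [parComp, parOfList] using CStep.proc h
  | succ n ih =>
    intro os j r h
    rw [parComp_succ, parComp_succ]
    induction j using Fin.cases with
    | zero => simpa [Fin.succ_ne_zero] using CStep.parL _ (CStep.proc h) hl
    | succ j =>
      have := ih (os := fun i => os i.succ) h
      have he : (fun i : Fin (n + 1) => Function.update os j.succ r i.succ) =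
          Function.update (fun i => os i.succ) j r := by
        funext i; simp [Function.update_apply]
      rw [he, Function.update_of_ne (Fin.succ_ne_zero j).symm]
      exact CStep.parR _ this hl

theorem CStep.exists_of_parComp {n : ℕ} :
    ∀ {os : Fin (n + 1) → Proc Name} {l : Label Name} {c : Conf Name}, l ≠ .tick →
      (∀ i j a x y, i ≠ j → Step (os i) (.act a) x → ¬ Step (os j) (.act a.co) y) →
      CStep (parComp os) l c →
      ∃ j r, Step (os j) l r ∧ c = parComp (Function.update os j r) := by
  induction n with
  | zero =>
    intro os l c _ _ h
    simp only [parComp, parOfList, List.ofFn_zero] at h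
    cases h with
    | proc h => exact ⟨0, _, h, by simp [parComp, parOfList]⟩
  | succ n ih =>
    intro os l c hl hns h
    have hns' : ∀ i j a x y, i ≠ j → Step (os (Fin.succ i)) (.act a) x →
        ¬ Step (os (Fin.succ j)) (.act a.co) y :=
      fun i j a x y hij => hns _ _ a x y fun h => hij (Fin.succ_injective _ h)
    have he : ∀ (j : Fin (n + 1)) r, (fun i : Fin (n + 1) => Function.update os j.succ r i.succ) =
        Function.update (fun i => os i.succ) j r := by
      intro j r; funext i; simp [Function.update_apply]
    rw [parComp_succ] at h
    cases h with
    | parL _ h _ =>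
      cases h with
      | proc h => exact ⟨0, _, h, by simp [parComp_succ, Fin.succ_ne_zero]⟩
    | parR _ h _ =>
      obtain ⟨j, r, hr, rfl⟩ := ih hl hns' h
      refine ⟨j.succ, r, hr, ?_⟩
      rw [parComp_succ, he, Function.update_of_ne (Fin.succ_ne_zero j).symm]
    | sync h₁ h₂ =>
      cases h₁ with
      | proc h₁ =>
        obtain ⟨j, r, hr, -⟩ := ih (by simp) hns' h₂
        exact absurd hr (hns _ _ _ _ _ (Fin.succ_ne_zero j).symm h₁)
    | tick => exact absurd rfl hl

theorem exists_parComp_tick_iff {n : ℕ} : ∀ {os : Fin (n + 1) → Proc Name},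
    (∃ c, CStep (parComp os) .tick c) ↔ ∀ i, ∃ r, Step (os i) .tick r := by
  induction n with
  | zero =>
    intro os
    simp only [parComp, parOfList, List.ofFn_zero]
    constructor
    · rintro ⟨c, h⟩ i
      obtain rfl : i = 0 := Fin.fin_one_eq_zero i
      cases h with
      | proc h => exact ⟨_, h⟩
    · intro h
      obtain ⟨r, h⟩ := h 0
      exact ⟨_, .proc h⟩
  | succ n ih =>
    intro os
    rw [parComp_succ, Fin.forall_fin_succ, ← ih]
    constructor
    · rintro ⟨c, h⟩
      cases h with
      | parL _ _ hl => exact absurd rfl hl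
      | parR _ _ hl => exact absurd rfl hl
      | tick h₁ h₂ =>
        cases h₁ with
        | proc h₁ => exact ⟨⟨_, h₁⟩, ⟨_, h₂⟩⟩
    · rintro ⟨⟨r, h₁⟩, ⟨c, h₂⟩⟩
      exact ⟨_, .tick (.proc h₁) h₂⟩

theorem Interface.not_step_co {n : ℕ} (𝕀 : Interface Name n) {os : Fin (n + 1) → Proc Name}
    (hos : ∀ i, Proc.acts (os i) ⊆ 𝕀.part i) (i j : Fin (n + 1)) (a : Act Name)
    (x y : Proc Name) (hij : i ≠ j) (hx : Step (os i) (.act a) x) :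
    ¬ Step (os j) (.act a.co) y := fun hy =>
  𝕀.disjoint i j hij _ (𝕀.coClosed i a (hos i (hx.mem_acts rfl))) (hos j (hy.mem_acts rfl))

theorem finite_setOf_step (p : Proc Name) :
    {x : Label Name × Proc Name | Step p x.1 x.2}.Finite := by
  obtain ⟨F, hF, hp, hcl⟩ := exists_finite_closed p
  refine (((Set.toFinite {Label.tau, Label.tick}).union
    ((Proc.acts_finite p).image Label.act)).prod hF).subset ?_
  rintro ⟨l, r⟩ h
  refine ⟨?_, hcl p hp l r h⟩
  cases l with
  | act a => exact Or.inr ⟨a, Step.mem_acts h rfl, rfl⟩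
  | tau => exact Or.inl (Or.inl rfl)
  | tick => exact Or.inl (Or.inr rfl)

/-- The transitions from `σ` of the parallel composition of the components `j` with `g j = i`. -/
def groupSteps {m : ℕ} {ι : Type} (g : Fin (m + 1) → ι) (i : ι) (σ : Fin (m + 1) → Proc Name) :
    Set (Label Name × (Fin (m + 1) → Proc Name)) :=
  {x | (x = (.tick, σ) ∧ ∀ j, g j = i → ∃ r, Step (σ j) .tick r) ∨
    (x.1 ≠ .tick ∧ ∃ j r, g j = i ∧ Step (σ j) x.1 r ∧ x.2 = Function.update σ j r)}

theorem groupSteps_finite {m : ℕ} {ι : Type} (g : Fin (m + 1) → ι) (i : ι)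
    (σ : Fin (m + 1) → Proc Name) : (groupSteps g i σ).Finite := by
  refine ((Set.finite_singleton (Label.tick, σ)).union (Set.finite_iUnion fun j =>
    (finite_setOf_step (σ j)).image fun x => (x.1, Function.update σ j x.2))).subset ?_
  rintro ⟨l, σ'⟩ (⟨h, -⟩ | ⟨-, j, r, -, h, rfl⟩)
  · exact Or.inl h
  · exact Or.inr (Set.mem_iUnion.2 ⟨j, (l, r), h, rfl⟩)

open Classical in
theorem exists_bisim_of_refinement {n m : ℕ} (𝕀 : Interface Name n) (𝕀' : Interface Name m)
    (href : ∀ j : Fin (m + 1), ∃ i : Fin (n + 1), 𝕀'.part j ⊆ 𝕀.part i)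
    (os' : Fin (m + 1) → Proc Name) (hos' : ∀ j, Proc.acts (os' j) ⊆ 𝕀'.part j) :
    ∃ os : Fin (n + 1) → Proc Name, (∀ i, Proc.acts (os i) ⊆ 𝕀.part i) ∧
      ∃ B, IsBisim B ∧ B (parComp os') (parComp os) := by
  choose g hg using href
  choose F hF hmem hcl using fun j => exists_finite_closed (os' j)
  let S : Set (Fin (m + 1) → Proc Name) :=
    Set.univ.pi fun j => F j ∩ {r | Proc.acts r ⊆ 𝕀'.part j}
  have hS : S.Finite := Set.Finite.pi fun j => (hF j).inter_of_left _
  let next (i : Fin (n + 1)) (σ : Fin (m + 1) → Proc Name) :=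
    (groupSteps_finite g i σ).toFinset.toList
  have hnext : ∀ {i σ x}, x ∈ next i σ ↔ x ∈ groupSteps g i σ := by simp [next]
  have hupd : ∀ {σ j l r}, σ ∈ S → Step (σ j) l r → Function.update σ j r ∈ S := by
    intro σ j l r hσ hr k _
    by_cases hk : k = j
    · subst hk
      rw [Function.update_self]
      exact ⟨hcl k _ (hσ k trivial).1 _ _ hr, hr.acts_subset.trans (hσ k trivial).2⟩
    · rw [Function.update_of_ne hk]
      exact hσ k trivial
  have hclS : ∀ i, ∀ σ ∈ S, ∀ x ∈ next i σ, x.2 ∈ S := by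
    intro i σ hσ x hx
    rcases hnext.1 hx with ⟨rfl, -⟩ | ⟨-, j, r, -, hr, he⟩
    · exact hσ
    · rw [he]
      exact hupd hσ hr
  have hact : ∀ i, ∀ σ ∈ S, ∀ a σ', (Label.act a, σ') ∈ next i σ → a ∈ 𝕀.part i := by
    intro i σ hσ a σ' hx
    rcases hnext.1 hx with ⟨h, -⟩ | ⟨-, j, r, rfl, hr, -⟩
    · cases h
    · exact hg j ((hσ j trivial).2 (hr.mem_acts rfl))
  have hinit : os' ∈ S := fun j _ => ⟨hmem j, hos' j⟩
  let os (i : Fin (n + 1)) := stateTerm (next i) (S.ncard + 1) [] os'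
  have hos : ∀ i, Proc.acts (os i) ⊆ 𝕀.part i := fun i =>
    acts_stateTerm_subset (hclS i) (hact i) _ _ _ hinit
  let R (u x : Conf Name) : Prop :=
    ∃ (ps : Fin (m + 1) → Proc Name) (qs : Fin (n + 1) → Proc Name)
      (σ : Fin (n + 1) → Fin (m + 1) → Proc Name),
      u = parComp ps ∧ x = parComp qs ∧ (∀ i, Proc.acts (qs i) ⊆ 𝕀.part i) ∧
      (∀ i, Denotes (next i) S (qs i) (σ i)) ∧ ∀ j, σ (g j) j = ps j
  have hR : ∀ {ps : Fin (m + 1) → Proc Name} {qs : Fin (n + 1) → Proc Name}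
      {σ : Fin (n + 1) → Fin (m + 1) → Proc Name} {j r x l},
      (∀ i, Proc.acts (qs i) ⊆ 𝕀.part i) → (∀ i, Denotes (next i) S (qs i) (σ i)) →
      (∀ j, σ (g j) j = ps j) → Step (qs (g j)) l x →
      Denotes (next (g j)) S x (Function.update (σ (g j)) j r) →
      R (parComp (Function.update ps j r)) (parComp (Function.update qs (g j) x)) := by
    intro ps qs σ j r x l hqs hD hσ hx hDx
    refine ⟨_, _, Function.update σ (g j) (Function.update (σ (g j)) j r), rfl, rfl, ?_, ?_, ?_⟩
    · intro i
      by_cases hi : i = g j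
      · subst hi
        rw [Function.update_self]
        exact hx.acts_subset.trans (hqs _)
      · rw [Function.update_of_ne hi]
        exact hqs i
    · intro i
      by_cases hi : i = g j
      · subst hi
        rwa [Function.update_self, Function.update_self]
      · rw [Function.update_of_ne hi, Function.update_of_ne hi]
        exact hD i
    · intro k
      by_cases hk : k = j
      · subst hk
        simp
      · rw [Function.update_of_ne hk, ← hσ k]
        by_cases hi : g k = g j
        · rw [hi, Function.update_self, Function.update_of_ne hk]
        · rw [Function.update_of_ne hi]
  refine ⟨os, hos, R, ⟨?_, ?_, ?_⟩,
    os', os, fun _ => os', rfl, rfl, hos, fun i => denotes_stateTerm hinit, fun _ => rfl⟩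
  · rintro _ _ l c ⟨ps, qs, σ, rfl, rfl, hqs, hD, hσ⟩ hl h
    have hps : ∀ j, Proc.acts (ps j) ⊆ 𝕀'.part j := fun j => by
      rw [← hσ j]; exact ((hD (g j)).1 j trivial).2
    obtain ⟨j, r, hr, rfl⟩ := CStep.exists_of_parComp hl (𝕀'.not_step_co hps) h
    obtain ⟨x, hx, hDx⟩ := (hD (g j)).exists_step hS (hclS _)
      (hnext.2 (Or.inr ⟨hl, j, r, rfl, by rwa [hσ j], rfl⟩)) hl
    exact ⟨_, CStep.parComp_update hl hx, hR hqs hD hσ hx hDx⟩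
  · rintro _ _ l c ⟨ps, qs, σ, rfl, rfl, hqs, hD, hσ⟩ hl h
    obtain ⟨i, x, hx, rfl⟩ := CStep.exists_of_parComp hl (𝕀.not_step_co hqs) h
    obtain ⟨σ', hσ', hDx⟩ := (hD i).of_step hS (hclS _) hx hl
    rcases hnext.1 hσ' with ⟨h, -⟩ | ⟨-, j, r, rfl, hr, rfl⟩
    · cases h
      exact absurd rfl hl
    · exact ⟨_, CStep.parComp_update hl (hσ j ▸ hr), hR hqs hD hσ hx hDx⟩
  · rintro _ _ ⟨ps, qs, σ, rfl, rfl, hqs, hD, hσ⟩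
    rw [exists_parComp_tick_iff, exists_parComp_tick_iff]
    constructor
    · intro h i
      refine ((hD i).exists_step_tick_iff hS (hclS _)).2 ⟨σ i, hnext.2 (Or.inl ⟨rfl, ?_⟩)⟩
      rintro j rfl
      rw [hσ j]
      exact h j
    · intro h j
      obtain ⟨σ', hσ'⟩ := ((hD (g j)).exists_step_tick_iff hS (hclS _)).1 (h (g j))
      rcases hnext.1 hσ' with ⟨-, h⟩ | ⟨h, -⟩
      · rw [← hσ j]
        exact h j rfl
      · exact absurd rfl h

/-- refinement yields a coarser uncoordinated preorder: if every part
of `𝕀'` is contained in some part of `𝕀`, then `p ⊑^𝕀_unc q` implies `p ⊑^𝕀'_unc q`. -/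
theorem uncLeq_refinement (Name : Type) [Countable Name] {n m : ℕ}
    (𝕀 : Interface Name n) (𝕀' : Interface Name m)
    (href : ∀ j : Fin (m + 1), ∃ i : Fin (n + 1), 𝕀'.part j ⊆ 𝕀.part i)
    (p q : Proc Name) (h : UncLeq 𝕀 p q) :
    UncLeq 𝕀' p q := by
  intro os' hos' hp
  obtain ⟨os, hos, B, hB, hb⟩ := exists_bisim_of_refinement 𝕀 𝕀' href os' hos'
  exact hB.mustPass hb (h os hos (hB.flip.mustPass hb hp))

end MultipartyTesting
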